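/- Let 0 < δ < 1 and let λ be a non-zero real number. With ℓ > 0 the absolute constant for which ∑_{m ∈ I ∩ ℕ} ρ(m) = ℓ |I| (log X)^{−1} + O(X^{1/2}(log X)^{−2}) for every subinterval I of [(δX)^{1/2}, X^{1/2}], there is a constant C = C(δ,λ) > 0 such that for all X ≥ 2 and all real α: |S̃_2(λα) − ℓ (log X)^{−1} T_2(λα)| ≤ C X^{1/2} (log X)^{−2} (1 + |α| X). -/

import Mathlib

open scoped Classical
open MeasureTheory

noncomputable section

/-- `e x = exp(2πix)` -/
def e (x : ℝ) : ℂ := Complex.exp (2 * Real.pi * Complex.I * x)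

/-- The exponential sum `S_k(α)` over primes `p` with `δX ≤ p^k ≤ X`. -/
def S (k δ X α : ℝ) : ℂ :=
  ∑ p ∈ (Finset.range (⌈X⌉₊ + 1)).filter
      (fun p : ℕ => p.Prime ∧ δ * X ≤ (p : ℝ) ^ k ∧ (p : ℝ) ^ k ≤ X),
    (Real.log p : ℂ) * e ((p : ℝ) ^ k * α)

/-- The exponential sum `U_k(α)` over naturals `n` with `δX ≤ n^k ≤ X`. -/
def U (k δ X α : ℝ) : ℂ :=
  ∑ n ∈ (Finset.range (⌈X⌉₊ + 1)).filter
      (fun n : ℕ => δ * X ≤ (n : ℝ) ^ k ∧ (n : ℝ) ^ k ≤ X),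
    e ((n : ℝ) ^ k * α)

/-- The exponential integral `T_k(α)`. -/
def T (k δ X α : ℝ) : ℂ :=
  ∫ t in (δ * X) ^ (1 / k)..(X ^ (1 / k)), e (α * t ^ k)

/-- Chebyshev theta function. -/
def theta (x : ℝ) : ℝ :=
  ∑ p ∈ (Finset.range (⌊x⌋₊ + 1)).filter Nat.Prime, Real.log p

/-- The generalized Selberg integral `𝒥_k(X,h)`. -/
def selbergJ (k X h : ℝ) : ℝ :=
  ∫ x in X..(2 * X),
    (theta ((x + h) ^ (1 / k)) - theta (x ^ (1 / k)) -
      ((x + h) ^ (1 / k) - x ^ (1 / k))) ^ 2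

/-- `ψ(m,z) = 1` iff every prime factor of `m` is at least `z`. -/
def psi (m : ℕ) (z : ℝ) : ℝ :=
  if ∀ p : ℕ, p.Prime → p ∣ m → z ≤ (p : ℝ) then 1 else 0

/-- The function `z(p)` of Harman–Kumchev. -/
def zfun (X : ℝ) (p : ℕ) : ℝ :=
  if (p : ℝ) < X ^ ((1 : ℝ) / 7) then X ^ ((5 : ℝ) / 28) * (p : ℝ) ^ (-(1 : ℝ) / 2)
  else if (p : ℝ) ≤ X ^ ((3 : ℝ) / 14) then (p : ℝ)
  else X ^ ((5 : ℝ) / 14) * (p : ℝ)⁻¹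

/-- The Harman–Kumchev sieve weight `ρ(m)`. -/
def rho (X : ℝ) (m : ℕ) : ℝ :=
  psi m (X ^ ((5 : ℝ) / 42)) -
    ∑ p ∈ (Finset.range (⌈X ^ ((1 : ℝ) / 4)⌉₊ + 1)).filter
        (fun p : ℕ => p.Prime ∧ X ^ ((5 : ℝ) / 42) ≤ (p : ℝ) ∧ (p : ℝ) < X ^ ((1 : ℝ) / 4) ∧ p ∣ m),
      psi (m / p) (zfun X p)

/-- The sieved exponential sum `S̃_2(α)`. -/
def Stilde (δ X α : ℝ) : ℂ :=
  ∑ m ∈ (Finset.range (⌈X⌉₊ + 1)).filter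
      (fun m : ℕ => δ * X ≤ (m : ℝ) ^ 2 ∧ (m : ℝ) ^ 2 ≤ X),
    (rho X m : ℂ) * e ((m : ℝ) ^ 2 * α)

/-- The Fejér-type kernel `K_η(α)`. -/
def Kf (η α : ℝ) : ℝ :=
  if α = 0 then η ^ 2 else (Real.sin (Real.pi * α * η) / (Real.pi * α)) ^ 2


theorem hasDerivAt_e (x : ℝ) : HasDerivAt e (2 * Real.pi * Complex.I * e x) x := by
  have h : HasDerivAt (fun y : ℝ => 2 * Real.pi * Complex.I * (y : ℂ))
      (2 * Real.pi * Complex.I) x := by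
    simpa using (Complex.ofRealCLM.hasDerivAt (x := x)).const_mul (2 * Real.pi * Complex.I)
  have h2 := h.cexp
  rw [mul_comm (Complex.exp _)] at h2
  exact h2

theorem norm_e (x : ℝ) : ‖e x‖ = 1 := by
  have : e x = Complex.exp (((2 * Real.pi * x : ℝ) : ℂ) * Complex.I) := by
    unfold e
    congr 1
    push_cast
    ring
  rw [this, Complex.norm_exp_ofReal_mul_I]

theorem hasDerivAt_e_sq (β t : ℝ) :
    HasDerivAt (fun s : ℝ => e (s ^ 2 * β))
      (((2 * t * β : ℝ) : ℂ) * (2 * Real.pi * Complex.I * e (t ^ 2 * β))) t := by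
  have h : HasDerivAt (fun s : ℝ => s ^ 2 * β) (2 * t * β) t := by
    simpa using (hasDerivAt_pow 2 t).mul_const β
  rw [← Complex.real_smul]
  exact (hasDerivAt_e (t ^ 2 * β)).scomp t h

theorem sum_Icc_zero_ite (n : ℕ) {E : Type*} [AddCommMonoid E] (N : ℕ) (g : ℕ → E) :
    ∑ k ∈ Finset.Icc 0 N, (if n ≤ k then g k else 0) = ∑ k ∈ Finset.Icc n N, g k := by
  rw [← Finset.sum_filter]
  congr 1
  ext k
  simp only [Finset.mem_filter, Finset.mem_Icc]
  omega

/-- Abel summation over the integers of `[a, b]`, both ends included. -/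
theorem sum_Icc_ceil_floor_mul (f f' : ℝ → ℂ) (c : ℕ → ℂ) {a b : ℝ} (ha : 0 ≤ a) (hab : a ≤ b)
    (hf : ∀ t, HasDerivAt f (f' t) t) (hf' : Continuous f') :
    ∑ k ∈ Finset.Icc ⌈a⌉₊ ⌊b⌋₊, c k * f k =
      f b * ∑ k ∈ Finset.Icc ⌈a⌉₊ ⌊b⌋₊, c k -
        ∫ t in Set.Icc a b, f' t * ∑ k ∈ Finset.Icc ⌈a⌉₊ ⌊t⌋₊, c k := by
  have hd : deriv f = f' := funext fun t => (hf t).deriv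
  have h := sum_mul_eq_sub_integral_mul (f := f) (fun k => if ⌈a⌉₊ ≤ k then c k else 0)
    (ha.trans hab) (fun t _ => (hf t).differentiableAt)
    (by rw [hd]; exact hf'.continuousOn.integrableOn_Icc)
  simp only [hd, mul_ite, mul_zero, sum_Icc_zero_ite ⌈a⌉₊] at h
  simp only [mul_comm (c _)]
  rw [h, ← integral_Icc_eq_integral_Ioc]
  congr 1
  refine setIntegral_eq_of_subset_of_forall_sdiff_eq_zero measurableSet_Icc
    (Set.Icc_subset_Icc_left ha) ?_
  rintro t ⟨ht, hta⟩
  have hlt : t < a := by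
    by_contra! hc
    exact hta ⟨hc, ht.2⟩
  have : ⌊t⌋₊ < ⌈a⌉₊ := by
    rw [Nat.lt_ceil]
    exact (Nat.floor_le ht.1).trans_lt hlt
  rw [Finset.Icc_eq_empty (by omega), Finset.sum_empty, mul_zero]

/-- If the partial sums of `c` over `[a, t]` are within `M` of `κ * (t - a)`, then
`∑ c k * f k` is close to `κ * ∫ f`. -/
theorem norm_sum_mul_sub_integral_le (f f' : ℝ → ℂ) (c : ℕ → ℝ) {a b B M κ : ℝ} (ha : 0 ≤ a)
    (hab : a ≤ b) (hf : ∀ t, HasDerivAt f (f' t) t) (hf' : Continuous f')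
    (hB : ∀ t ∈ Set.Icc a b, ‖f' t‖ ≤ B)
    (hM : ∀ t ∈ Set.Icc a b, |∑ k ∈ Finset.Icc ⌈a⌉₊ ⌊t⌋₊, c k - κ * (t - a)| ≤ M) :
    ‖∑ k ∈ Finset.Icc ⌈a⌉₊ ⌊b⌋₊, (c k : ℂ) * f k - (κ : ℂ) * ∫ t in a..b, f t‖ ≤
      ‖f b‖ * M + B * M * (b - a) := by
  have hparts : ∫ t in a..b, f t = f b * (b - a) - ∫ t in Set.Icc a b, f' t * (t - a) := by
    have h := intervalIntegral.integral_mul_deriv_eq_deriv_mul (a := a) (b := b) (u := f)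
      (u' := f') (v := fun t : ℝ => ((t : ℂ) - a)) (v' := fun _ => 1) (fun t _ => hf t)
      (fun t _ => by simpa using (Complex.ofRealCLM.hasDerivAt (x := t)).sub_const (a : ℂ))
      (hf'.intervalIntegrable a b) (by simp)
    rw [integral_Icc_eq_integral_Ioc, ← intervalIntegral.integral_of_le hab]
    simpa using h
  set D : ℝ → ℂ := fun t =>
    ((∑ k ∈ Finset.Icc ⌈a⌉₊ ⌊t⌋₊, c k - κ * (t - a) : ℝ) : ℂ) with hD
  have hDM : ∀ t ∈ Set.Icc a b, ‖D t‖ ≤ M := fun t ht => by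
    simpa only [hD, Complex.norm_real, Real.norm_eq_abs] using hM t ht
  have hM0 : 0 ≤ M := (norm_nonneg _).trans (hDM b ⟨hab, le_rfl⟩)
  have hint : ∫ t in Set.Icc a b, f' t * D t =
      (∫ t in Set.Icc a b, f' t * ∑ k ∈ Finset.Icc ⌈a⌉₊ ⌊t⌋₊, (c k : ℂ)) -
        κ * ∫ t in Set.Icc a b, f' t * (t - a) := by
    rw [← integral_const_mul, ← integral_sub]
    · refine integral_congr_ae (Filter.Eventually.of_forall fun t => ?_)
      simp only [hD]
      push_cast
      ring
    · exact integrableOn_mul_sum_Icc _ ha hf'.continuousOn.integrableOn_Icc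
    · exact (Continuous.continuousOn (by fun_prop)).integrableOn_Icc
  have key : ∑ k ∈ Finset.Icc ⌈a⌉₊ ⌊b⌋₊, (c k : ℂ) * f k - (κ : ℂ) * ∫ t in a..b, f t =
      f b * D b - ∫ t in Set.Icc a b, f' t * D t := by
    rw [sum_Icc_ceil_floor_mul f f' (fun k => (c k : ℂ)) ha hab hf hf', hparts, hint]
    simp only [hD]
    push_cast
    ring
  rw [key]
  refine (norm_sub_le _ _).trans (add_le_add ?_ ?_)
  · rw [norm_mul]
    exact mul_le_mul_of_nonneg_left (hDM b ⟨hab, le_rfl⟩) (norm_nonneg _)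
  · have h := norm_setIntegral_le_of_norm_le_const (μ := volume) (s := Set.Icc a b)
      (f := fun t => f' t * D t) (C := B * M) (by simp) (fun t ht => by
        rw [norm_mul]
        exact mul_le_mul (hB t ht) (hDM t ht) (norm_nonneg _) ((norm_nonneg _).trans (hB t ht)))
    simpa [Real.volume_real_Icc_of_le hab] using h

/-- For `X ≥ 1`, the summation range of `Stilde` consists of the integers of
`[(δX)^{1/2}, X^{1/2}]`. -/
theorem Stilde_eq_sum_Icc {δ X : ℝ} (hX : 1 ≤ X) (α : ℝ) :
    Stilde δ X α = ∑ m ∈ Finset.Icc ⌈√(δ * X)⌉₊ ⌊√X⌋₊, (rho X m : ℂ) * e ((m : ℝ) ^ 2 * α) := by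
  unfold Stilde
  refine Finset.sum_congr ?_ fun _ _ => rfl
  ext m
  simp only [Finset.mem_filter, Finset.mem_range, Finset.mem_Icc, Nat.ceil_le,
    Nat.le_floor_iff (Real.sqrt_nonneg X), Real.sqrt_le_left (Nat.cast_nonneg m),
    Real.le_sqrt (Nat.cast_nonneg m) (zero_le_one.trans hX)]
  refine ⟨fun h => h.2, fun h => ⟨?_, h⟩⟩
  have hmX : (m : ℝ) ≤ X := by nlinarith [h.2]
  exact Nat.lt_succ_of_le (by exact_mod_cast hmX.trans (Nat.le_ceil X))

theorem T_two_eq (δ X α : ℝ) : T 2 δ X α = ∫ t in √(δ * X)..√X, e (t ^ 2 * α) := by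
  unfold T
  simp only [Real.sqrt_eq_rpow, Real.rpow_two, mul_comm α]

theorem statement15 (δ l : ℝ) (hδ0 : 0 < δ) (hδ1 : δ < 1) (hl : l ≠ 0)
    (ℓ : ℝ) (hℓ : 0 < ℓ)
    (hℓprop : ∃ C' > (0 : ℝ), ∀ X ≥ (2 : ℝ), ∀ a b : ℝ,
      (δ * X) ^ ((1 : ℝ) / 2) ≤ a → a ≤ b → b ≤ X ^ ((1 : ℝ) / 2) →
      |(∑ m ∈ Finset.Icc ⌈a⌉₊ ⌊b⌋₊, rho X m) - ℓ * (b - a) * (Real.log X)⁻¹| ≤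
        C' * X ^ ((1 : ℝ) / 2) * ((Real.log X) ^ 2)⁻¹) :
    ∃ C > 0, ∀ X ≥ (2 : ℝ), ∀ α : ℝ,
      ‖Stilde δ X (l * α) - ((ℓ * (Real.log X)⁻¹ : ℝ) : ℂ) * T 2 δ X (l * α)‖ ≤
        C * X ^ ((1 : ℝ) / 2) * ((Real.log X) ^ 2)⁻¹ * (1 + |α| * X) := by
  obtain ⟨C', hC', hprop⟩ := hℓprop
  refine ⟨C' * (1 + 4 * Real.pi * |l|), by positivity, fun X hX α => ?_⟩
  simp only [← Real.sqrt_eq_rpow] at hprop ⊢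
  have hX0 : 0 < X := by linarith
  have hab : √(δ * X) ≤ √X := Real.sqrt_le_sqrt (by nlinarith)
  set M : ℝ := C' * √X * ((Real.log X) ^ 2)⁻¹ with hM
  have hM0 : 0 ≤ M := by positivity
  have h := norm_sum_mul_sub_integral_le (fun t => e (t ^ 2 * (l * α))) _ (rho X)
    (a := √(δ * X)) (b := √X) (B := 4 * Real.pi * |l * α| * √X) (M := M)
    (κ := ℓ * (Real.log X)⁻¹) (Real.sqrt_nonneg _) hab (hasDerivAt_e_sq (l * α))
    (by
      have : Continuous e := continuous_iff_continuousAt.2 fun x => (hasDerivAt_e x).continuousAt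
      fun_prop)
    (fun t ht => by
      have ht0 : 0 ≤ t := (Real.sqrt_nonneg _).trans ht.1
      simp only [norm_mul, Complex.norm_real, Real.norm_eq_abs, norm_e, Complex.norm_I,
        abs_mul, abs_of_nonneg ht0, Complex.norm_ofNat, abs_of_pos Real.pi_pos, abs_two, mul_one]
      have : 4 * Real.pi * (|l| * |α|) * t ≤ 4 * Real.pi * (|l| * |α|) * √X :=
        mul_le_mul_of_nonneg_left ht.2 (by positivity)
      linarith)
    (fun t ht => by
      have := hprop X hX _ t le_rfl ht.1 ht.2
      rwa [mul_right_comm] at this)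
  rw [norm_e, ← T_two_eq, ← Stilde_eq_sum_Icc (by linarith)] at h
  refine h.trans ?_
  have hsq : √X * (√X - √(δ * X)) ≤ X := by
    nlinarith [Real.mul_self_sqrt hX0.le, Real.sqrt_nonneg X, Real.sqrt_nonneg (δ * X)]
  calc 1 * M + 4 * Real.pi * |l * α| * √X * M * (√X - √(δ * X))
      = M + 4 * Real.pi * |l| * |α| * M * (√X * (√X - √(δ * X))) := by rw [abs_mul]; ring
    _ ≤ M + 4 * Real.pi * |l| * |α| * M * X := by gcongr
    _ ≤ M + 4 * Real.pi * |l| * |α| * M * X + 4 * Real.pi * |l| * M + M * (|α| * X) := by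
      have h1 : 0 ≤ 4 * Real.pi * |l| * M := by positivity
      have h2 : 0 ≤ M * (|α| * X) := by positivity
      linarith
    _ = C' * (1 + 4 * Real.pi * |l|) * √X * ((Real.log X) ^ 2)⁻¹ * (1 + |α| * X) := by
      rw [hM]; ring

end
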